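/- arXiv:2002.09562 — 3 statements merged into one kernel-verified Lean document; each statement's English description precedes it below -/
import Mathlib

section
/- Harmonic realizations of a d-dimensional topological crystal X are unique up to affine transformations of ℝ^d: if (Φ_1, ρ_1) and (Φ_2, ρ_2) are harmonic periodic realizations of X with period lattices Γ_1 = ρ_1(G) and Γ_2 = ρ_2(G), then there exist A ∈ GL(d, ℝ) and b ∈ ℝ^d such that Φ_1 = AΦ_2 + b and ρ_1 = A ρ_2. -/
noncomputable section

/-- A `d`-dimensional topological crystal: a connected non-oriented locally finite graph
(with origin `o`, terminus `t` and edge reversal `bar`) together with a free action of the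
free abelian group `ℤ^d` with finite quotient graph (given by finite sets `Vrep`, `Erep` of
orbit representatives). `star v` is the finite set of edges emanating from `v`. -/
structure Crystal (d : ℕ) where
  V : Type
  E : Type
  o : E → V
  t : E → V
  bar : E → E
  bar_bar : ∀ e, bar (bar e) = e
  bar_ne : ∀ e, bar e ≠ e
  o_bar : ∀ e, o (bar e) = t e
  act : (Fin d → ℤ) → V → V
  acte : (Fin d → ℤ) → E → E
  act_zero : ∀ v, act 0 v = v
  act_add : ∀ a b v, act (a + b) v = act a (act b v)
  acte_zero : ∀ e, acte 0 e = e
  acte_add : ∀ a b e, acte (a + b) e = acte a (acte b e)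
  o_acte : ∀ a e, o (acte a e) = act a (o e)
  t_acte : ∀ a e, t (acte a e) = act a (t e)
  bar_acte : ∀ a e, bar (acte a e) = acte a (bar e)
  free : ∀ a v, act a v = v → a = 0
  conn : ∀ u v : V, ∃ L : List E,
    L.Chain' (fun e f => t e = o f) ∧
    ((L = [] ∧ u = v) ∨ ∃ hne : L ≠ [], o (L.head hne) = u ∧ t (L.getLast hne) = v)
  star : V → Finset E
  star_spec : ∀ v e, e ∈ star v ↔ o e = v
  Erep : Finset E
  Erep_spec : ∀ e : E, ∃! p : (Fin d → ℤ) × Erep, acte p.1 p.2.1 = e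
  Vrep : Finset V
  Vrep_spec : ∀ v : V, ∃! p : (Fin d → ℤ) × Vrep, act p.1 p.2.1 = v

/-- A periodic realization `(Φ, ρ)` of a topological crystal in `ℝ^d`. -/
structure PeriodicRealization {d : ℕ} (C : Crystal d) where
  Φ : C.V → EuclideanSpace ℝ (Fin d)
  ρ : (Fin d → ℤ) → EuclideanSpace ℝ (Fin d)
  ρ_add : ∀ a b, ρ (a + b) = ρ a + ρ b
  ρ_inj : Function.Injective ρ
  equivariant : ∀ a v, Φ (C.act a v) = Φ v + ρ a

/-- The energy `E(Φ) = Σ_{e ∈ E₀} |Φ(t e) − Φ(o e)|²` (summed over the quotient graph). -/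
def energy {d : ℕ} (C : Crystal d) (P : PeriodicRealization C) : ℝ :=
  ∑ e ∈ C.Erep, ‖P.Φ (C.t e) - P.Φ (C.o e)‖ ^ 2

/-- The volume of the fundamental domain of the period lattice `Γ = ρ(ℤ^d)`. -/
def latVol {d : ℕ} (ρ : (Fin d → ℤ) → EuclideanSpace ℝ (Fin d)) : ℝ :=
  |(Matrix.of fun i j : Fin d => ρ (Pi.single j 1) i).det|

theorem max_principle {d : ℕ} (C : Crystal d) (g : C.V → ℝ)
    (hper : ∀ a v, g (C.act a v) = g v)
    (hh : ∀ v : C.V, ∑ e ∈ C.star v, (g (C.t e) - g (C.o e)) = 0) (u w : C.V) :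
    g u = g w := by
  classical
  have hmem : ∀ v : C.V, ∃ x ∈ C.Vrep, g x = g v := by
    intro v
    obtain ⟨p, hp, -⟩ := C.Vrep_spec v
    refine ⟨p.2.1, p.2.2, ?_⟩
    rw [← hper p.1]
    exact congrArg g hp
  obtain ⟨x0, hx0, -⟩ := hmem u
  obtain ⟨m, -, hmax⟩ := C.Vrep.exists_max_image g ⟨x0, hx0⟩
  have hle : ∀ v, g v ≤ g m := by
    intro v
    obtain ⟨x, hx, hxv⟩ := hmem v
    rw [← hxv]
    exact hmax x hx
  have hnb : ∀ e, g (C.o e) = g m → g (C.t e) = g m := by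
    intro e he
    have h1 : ∀ e' ∈ C.star (C.o e), g (C.t e') - g (C.o e') ≤ 0 := by
      intro e' he'
      rw [C.star_spec] at he'
      rw [he', he]
      linarith [hle (C.t e')]
    have h2 := (Finset.sum_eq_zero_iff_of_nonpos h1).1 (hh (C.o e)) e ((C.star_spec _ _).2 rfl)
    linarith
  have hpath : ∀ (L : List C.E) (hc : L.IsChain (fun e f => C.t e = C.o f)) (hne : L ≠ []),
      g (C.o (L.head hne)) = g m → g (C.t (L.getLast hne)) = g m := by
    intro L
    induction L with
    | nil => intro _ hne; exact absurd rfl hne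
    | cons e L ih =>
      intro hc hne h
      cases L with
      | nil => exact hnb e h
      | cons f L =>
        rw [List.isChain_cons_cons] at hc
        have h3 : g (C.t e) = g m := hnb e h
        rw [hc.1] at h3
        exact ih hc.2 (by simp) h3
  have hall : ∀ v, g v = g m := by
    intro v
    obtain ⟨L, hc, h | ⟨hne, h1, h2⟩⟩ := C.conn m v
    · rw [h.2]
    · rw [← h2]
      exact hpath L hc hne (by rw [h1])
  rw [hall u, hall w]

theorem rho_expand {d : ℕ} {C : Crystal d} (P : PeriodicRealization C) (a : Fin d → ℤ) :
    P.ρ a = ∑ i, a i • P.ρ (Pi.single i 1) := by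
  let r : (Fin d → ℤ) →+ EuclideanSpace ℝ (Fin d) := AddMonoidHom.mk' P.ρ P.ρ_add
  change r a = ∑ i, a i • r (Pi.single i 1)
  conv_lhs => rw [pi_eq_sum_univ' a]
  rw [map_sum]
  refine Finset.sum_congr rfl fun i _ => ?_
  rw [map_zsmul]

/-- Harmonic realizations of a topological crystal are unique up to affine
transformations: if `(Φ₁, ρ₁)` and `(Φ₂, ρ₂)` are harmonic periodic realizations (with
genuine period lattices), then there are `A ∈ GL(d, ℝ)` and `b ∈ ℝ^d` with
`Φ₁ = A Φ₂ + b` and `ρ₁ = A ρ₂`. -/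
theorem stmt3 {d : ℕ} (C : Crystal d) (P₁ P₂ : PeriodicRealization C)
    (hlat₁ : LinearIndependent ℝ fun i : Fin d => P₁.ρ (Pi.single i 1))
    (hlat₂ : LinearIndependent ℝ fun i : Fin d => P₂.ρ (Pi.single i 1))
    (harm₁ : ∀ v : C.V, ∑ e ∈ C.star v, (P₁.Φ (C.t e) - P₁.Φ (C.o e)) = 0)
    (harm₂ : ∀ v : C.V, ∑ e ∈ C.star v, (P₂.Φ (C.t e) - P₂.Φ (C.o e)) = 0) :
    ∃ (A : EuclideanSpace ℝ (Fin d) ≃ₗ[ℝ] EuclideanSpace ℝ (Fin d))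
      (b : EuclideanSpace ℝ (Fin d)),
      (∀ v : C.V, P₁.Φ v = A (P₂.Φ v) + b) ∧ (∀ a : Fin d → ℤ, P₁.ρ a = A (P₂.ρ a)) := by
  classical
  let b₁ := basisOfLinearIndependentOfCardEqFinrank' _ hlat₁ (by simp)
  let b₂ := basisOfLinearIndependentOfCardEqFinrank' _ hlat₂ (by simp)
  let A := b₂.equiv b₁ (Equiv.refl _)
  have hA : ∀ i, A (P₂.ρ (Pi.single i 1)) = P₁.ρ (Pi.single i 1) := by
    intro i
    have h := b₂.equiv_apply i b₁ (Equiv.refl _)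
    simpa [b₁, b₂, A] using h
  have hρ : ∀ a : Fin d → ℤ, P₁.ρ a = A (P₂.ρ a) := by
    intro a
    rw [rho_expand P₁, rho_expand P₂, map_sum]
    refine Finset.sum_congr rfl fun i _ => ?_
    rw [map_zsmul, hA]
  have hconst : ∀ u w, P₁.Φ u - A (P₂.Φ u) = P₁.Φ w - A (P₂.Φ w) := by
    intro u w
    ext i
    refine max_principle C (fun v => (P₁.Φ v - A (P₂.Φ v)) i) ?_ ?_ u w
    · intro a v
      simp only [P₁.equivariant, P₂.equivariant, map_add, hρ a]
      rw [add_sub_add_right_eq_sub]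
    · intro v
      have h : ∑ e ∈ C.star v, ((P₁.Φ (C.t e) - P₁.Φ (C.o e))
          - A (P₂.Φ (C.t e) - P₂.Φ (C.o e))) = 0 := by
        rw [Finset.sum_sub_distrib, ← map_sum, harm₁, harm₂, map_zero, sub_zero]
      have h' := congrArg (EuclideanSpace.proj (𝕜 := ℝ) i) h
      rw [map_sum, map_zero] at h'
      rw [← h']
      refine Finset.sum_congr rfl fun e _ => ?_
      simp only [map_sub, PiLp.sub_apply, PiLp.proj_apply]
      ring
  by_cases hV : Nonempty C.V
  · obtain ⟨w⟩ := hV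
    refine ⟨A, P₁.Φ w - A (P₂.Φ w), fun v => ?_, hρ⟩
    rw [← hconst v w]
    abel
  · exact ⟨A, 0, fun v => absurd ⟨v⟩ hV, hρ⟩
end
end

section
/- For any d-dimensional topological crystal X there exists a standard realization, and it is unique up to Euclidean motions of ℝ^d: any two standard realizations of X differ by composition with an element of O(d) ⋉ ℝ^d. -/
noncomputable section

/-- A standard realization: a periodic realization minimizing the energy among all
periodic realizations whose period lattice has volume `1`. -/
def IsStandard {d : ℕ} (C : Crystal d) (P : PeriodicRealization C) : Prop :=
  latVol P.ρ = 1 ∧ ∀ Q : PeriodicRealization C, latVol Q.ρ = 1 → energy C P ≤ energy C Q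

open Matrix in
theorem aux_det {d : ℕ} (T : Matrix (Fin d) (Fin d) ℝ) (hT : |T.det| = 1) :
    ∃ O : Matrix (Fin d) (Fin d) ℝ, Oᵀ * O = 1 ∧ 1 ≤ |((1/2 : ℝ) • (T + O)).det| := by
  have hA : (Tᵀ * T).IsHermitian := by
    simpa using Matrix.isHermitian_conjTranspose_mul_self T
  have hps : (Tᵀ * T).PosSemidef := by
    simpa using Matrix.posSemidef_conjTranspose_mul_self T
  have hdet : ∏ i, hA.eigenvalues i = 1 := by
    have h1 := hA.det_eq_prod_eigenvalues
    simp only [Matrix.det_mul, Matrix.det_transpose, RCLike.ofReal_real_eq_id, id] at h1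
    rw [← h1, ← abs_mul_abs_self, hT, one_mul]
  have hnn : ∀ i, 0 ≤ hA.eigenvalues i := fun i => by
    have := hps.eigenvalues_nonneg i
    exact this
  have hpos : ∀ i, 0 < hA.eigenvalues i := fun i => by
    refine lt_of_le_of_ne (hnn i) fun h => ?_
    rw [Finset.prod_eq_zero (Finset.mem_univ i) h.symm] at hdet
    exact zero_ne_one hdet
  obtain ⟨U, hU1, hU2, hUD⟩ : ∃ U : Matrix (Fin d) (Fin d) ℝ, Uᵀ * U = 1 ∧ U * Uᵀ = 1 ∧
      Uᵀ * (Tᵀ * T) * U = diagonal hA.eigenvalues := by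
    have h1 : (hA.eigenvectorUnitary : Matrix (Fin d) (Fin d) ℝ)ᵀ * (hA.eigenvectorUnitary : Matrix (Fin d) (Fin d) ℝ) = 1 := by
      have := Unitary.coe_star_mul_self hA.eigenvectorUnitary
      rwa [Matrix.star_eq_conjTranspose, Matrix.conjTranspose_eq_transpose_of_trivial] at this
    refine ⟨hA.eigenvectorUnitary, h1, mul_eq_one_comm.mp h1, ?_⟩
    have h2 := hA.spectral_theorem
    rw [Unitary.conjStarAlgAut_apply, Matrix.star_eq_conjTranspose, Matrix.conjTranspose_eq_transpose_of_trivial] at h2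
    generalize (hA.eigenvectorUnitary : Matrix (Fin d) (Fin d) ℝ) = U at *
    have h3 : (RCLike.ofReal ∘ hA.eigenvalues : Fin d → ℝ) = hA.eigenvalues := by
      ext; simp
    rw [h3] at h2
    generalize diagonal hA.eigenvalues = D at *
    rw [h2]
    calc Uᵀ * (U * D * Uᵀ) * U = (Uᵀ * U) * D * (Uᵀ * U) := by simp only [Matrix.mul_assoc]
      _ = D := by rw [h1]; simp
  set lam := hA.eigenvalues
  set s : Fin d → ℝ := fun i => √(lam i) with hs
  have hspos : ∀ i, 0 < s i := fun i => Real.sqrt_pos.mpr (hpos i)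
  set W := T * U * diagonal (fun i => (s i)⁻¹) with hW
  have hWW : Wᵀ * W = 1 := by
    rw [hW, Matrix.transpose_mul, Matrix.transpose_mul, Matrix.diagonal_transpose]
    calc diagonal (fun i => (s i)⁻¹) * (Uᵀ * Tᵀ) * (T * U * diagonal (fun i => (s i)⁻¹))
        = diagonal (fun i => (s i)⁻¹) * (Uᵀ * (Tᵀ * T) * U) * diagonal (fun i => (s i)⁻¹) := by
          simp only [Matrix.mul_assoc]
      _ = 1 := by
          rw [hUD, Matrix.diagonal_mul_diagonal, Matrix.diagonal_mul_diagonal, ← Matrix.diagonal_one]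
          congr 1; ext i
          have h4 : lam i = s i * s i := (Real.mul_self_sqrt (hnn i)).symm
          have := (hspos i).ne'
          rw [h4]; field_simp
  have hTW : T = W * diagonal s * Uᵀ := by
    rw [hW, Matrix.mul_assoc (T * U), Matrix.diagonal_mul_diagonal]
    have : (diagonal fun i => (s i)⁻¹ * s i) = (1 : Matrix (Fin d) (Fin d) ℝ) := by
      rw [← Matrix.diagonal_one]; congr 1; ext i; exact inv_mul_cancel₀ (hspos i).ne'
    rw [this, Matrix.mul_one, Matrix.mul_assoc, hU2, Matrix.mul_one]
  have habs : ∀ M : Matrix (Fin d) (Fin d) ℝ, Mᵀ * M = 1 → |M.det| = 1 := fun M hM => by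
    have := congrArg Matrix.det hM
    rw [Matrix.det_mul, Matrix.det_transpose, Matrix.det_one, ← abs_mul_abs_self] at this
    nlinarith [abs_nonneg M.det]
  refine ⟨W * Uᵀ, ?_, ?_⟩
  · rw [Matrix.transpose_mul, Matrix.transpose_transpose]
    calc U * Wᵀ * (W * Uᵀ) = U * (Wᵀ * W) * Uᵀ := by simp only [Matrix.mul_assoc]
      _ = 1 := by rw [hWW, Matrix.mul_one, hU2]
  · have h5 : (1/2 : ℝ) • (T + W * Uᵀ) = W * diagonal (fun i => (s i + 1)/2) * Uᵀ := by
      have : diagonal (fun i => (s i + 1)/2) = (1/2 : ℝ) • (diagonal s + 1) := by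
        rw [← Matrix.diagonal_one, Matrix.diagonal_add, ← Matrix.diagonal_smul]
        congr 1; ext i; simp; ring
      rw [this, Matrix.mul_smul, Matrix.smul_mul, Matrix.mul_add, Matrix.add_mul, ← hTW, Matrix.mul_one]
    rw [h5, Matrix.det_mul, Matrix.det_mul, abs_mul, abs_mul, habs W hWW, Matrix.det_transpose,
      habs U hU1, one_mul, mul_one, Matrix.det_diagonal]
    have hsp : ∏ i, s i = 1 := by
      have : (∏ i, s i) * (∏ i, s i) = 1 := by
        rw [← Finset.prod_mul_distrib, ← hdet]
        exact Finset.prod_congr rfl fun i _ => Real.mul_self_sqrt (hnn i)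
      have h0 : 0 < ∏ i, s i := Finset.prod_pos fun i _ => hspos i
      nlinarith
    have h6 : ∏ i, √(s i) ≤ ∏ i, (s i + 1)/2 := by
      refine Finset.prod_le_prod (fun i _ => Real.sqrt_nonneg _) fun i _ => ?_
      nlinarith [sq_nonneg (√(s i) - 1), Real.mul_self_sqrt (hspos i).le]
    have h7 : ∏ i, √(s i) = 1 := by
      have : (∏ i, √(s i)) * (∏ i, √(s i)) = 1 := by
        rw [← Finset.prod_mul_distrib, ← hsp]
        exact Finset.prod_congr rfl fun i _ => Real.mul_self_sqrt (hspos i).le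
      have h0 : 0 < ∏ i, √(s i) := Finset.prod_pos fun i _ => Real.sqrt_pos.mpr (hspos i)
      nlinarith
    rw [h7] at h6
    exact h6.trans (le_abs_self _)

theorem aux_isom {d : ℕ} (O : Matrix (Fin d) (Fin d) ℝ) (hO : O.transpose * O = 1) :
    ∃ A : EuclideanSpace ℝ (Fin d) ≃ₗᵢ[ℝ] EuclideanSpace ℝ (Fin d),
      ∀ x i, A x i = ∑ j, O i j * x j := by
  let A : EuclideanSpace ℝ (Fin d) →ₗᵢ[ℝ] EuclideanSpace ℝ (Fin d) :=
    { Matrix.toEuclideanLin O with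
      norm_map' := fun x => by
        have h : dotProduct (O.mulVec x.ofLp) (O.mulVec x.ofLp) = dotProduct x.ofLp x.ofLp := by
          rw [Matrix.dotProduct_mulVec, ← Matrix.mulVec_transpose, Matrix.mulVec_mulVec, hO,
            Matrix.one_mulVec]
        change ‖Matrix.toEuclideanLin O x‖ = ‖x‖
        rw [EuclideanSpace.norm_eq, EuclideanSpace.norm_eq]
        congr 1
        simp only [Real.norm_eq_abs, sq_abs]
        simp only [sq]
        exact h }
  refine ⟨A.toLinearIsometryEquiv rfl, fun x i => ?_⟩
  rfl

theorem aux_lin {d : ℕ} (ρ : (Fin d → ℤ) → EuclideanSpace ℝ (Fin d))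
    (hadd : ∀ a b, ρ (a + b) = ρ a + ρ b) (a : Fin d → ℤ) :
    ρ a = ∑ j, (a j : ℝ) • ρ (Pi.single j 1) := by
  let f : (Fin d → ℤ) →+ EuclideanSpace ℝ (Fin d) := AddMonoidHom.mk' ρ hadd
  have h : a = ∑ j, a j • (Pi.single j 1 : Fin d → ℤ) := by
    ext i
    simp [Finset.sum_apply, Pi.single_apply]
  have h2 : f a = ∑ j, a j • f (Pi.single j 1) := by
    conv_lhs => rw [h]
    rw [map_sum]
    simp only [map_zsmul]
  simp only [Int.cast_smul_eq_zsmul]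
  exact h2

theorem aux_inj {d : ℕ} (ρ : (Fin d → ℤ) → EuclideanSpace ℝ (Fin d))
    (hadd : ∀ a b, ρ (a + b) = ρ a + ρ b) (h : latVol ρ = 1) : Function.Injective ρ := by
  have hu : IsUnit (Matrix.of fun i j : Fin d => ρ (Pi.single j 1) i) := by
    rw [Matrix.isUnit_iff_isUnit_det, isUnit_iff_ne_zero]
    intro h0
    simp [latVol, h0] at h
  have hinj := Matrix.mulVec_injective_iff_isUnit.mpr hu
  intro a b hab
  have key : ∀ a : Fin d → ℤ, (Matrix.of fun i j : Fin d => ρ (Pi.single j 1) i).mulVec (fun j => (a j : ℝ)) = (ρ a).ofLp := by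
    intro a
    ext i
    rw [aux_lin ρ hadd a]
    simp [Matrix.mulVec, dotProduct, mul_comm]
  have := hinj ((key a).trans ((congrArg _ hab).trans (key b).symm))
  ext j
  exact_mod_cast congrFun this j

theorem aux_const {d : ℕ} (C : Crystal d) (D : C.V → EuclideanSpace ℝ (Fin d))
    (τ : (Fin d → ℤ) → EuclideanSpace ℝ (Fin d))
    (hD : ∀ a v, D (C.act a v) = D v + τ a)
    (h0 : ∀ e ∈ C.Erep, D (C.t e) - D (C.o e) = 0) (u v : C.V) : D u = D v := by
  have he : ∀ e, D (C.t e) = D (C.o e) := by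
    intro e
    obtain ⟨⟨a, e0⟩, rfl, -⟩ := C.Erep_spec e
    simp only [C.t_acte, C.o_acte, hD]
    rw [sub_eq_zero.mp (h0 e0.1 e0.2)]
  obtain ⟨L, hc, h | ⟨hne, h1, h2⟩⟩ := C.conn u v
  · rw [h.2]
  · subst h1 h2
    induction L with
    | nil => exact absurd rfl hne
    | cons e L ih =>
      cases L with
      | nil => simpa using (he e).symm
      | cons f L =>
        have hc' := List.isChain_cons_cons.mp hc
        have := ih hc'.2 (by simp)
        rw [List.getLast_cons (by simp), ← this]
        simp only [List.head_cons]
        rw [← he e, hc'.1]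


theorem aux_scale {d : ℕ} (hd : d ≠ 0) (v : ℝ) (hv : 1 ≤ v) :
    ∃ s : ℝ, 0 < s ∧ s ≤ 1 ∧ s ^ d * v = 1 := by
  have hv0 : 0 < v := by linarith
  refine ⟨(v⁻¹) ^ ((d : ℝ)⁻¹), by positivity, ?_, ?_⟩
  · exact Real.rpow_le_one (by positivity) (inv_le_one_of_one_le₀ hv) (by positivity)
  · rw [Real.rpow_inv_natCast_pow (by positivity) hd, inv_mul_cancel₀ hv0.ne']

theorem aux_unique {d : ℕ} (C : Crystal d) (P Q : PeriodicRealization C)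
    (hP : IsStandard C P) (hQ : IsStandard C Q) :
      ∃ (A : EuclideanSpace ℝ (Fin d) ≃ₗᵢ[ℝ] EuclideanSpace ℝ (Fin d))
        (b : EuclideanSpace ℝ (Fin d)),
        ∀ v : C.V, P.Φ v = A (Q.Φ v) + b := by
  by_cases hd : d = 0
  · subst hd
    exact ⟨LinearIsometryEquiv.refl ℝ _, 0, fun v => Subsingleton.elim _ _⟩
  set RP := (Matrix.of fun i j : Fin d => P.ρ (Pi.single j 1) i) with hRP
  set RQ := (Matrix.of fun i j : Fin d => Q.ρ (Pi.single j 1) i) with hRQ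
  have hdP : |RP.det| = 1 := hP.1
  have hdQ : |RQ.det| = 1 := hQ.1
  have hu : IsUnit RQ.det := by
    rw [isUnit_iff_ne_zero]; intro h; simp [h] at hdQ
  obtain ⟨O, hO, hOdet⟩ := aux_det (RP * RQ⁻¹) (by
    rw [Matrix.det_mul, Matrix.det_nonsing_inv, Ring.inverse_eq_inv, abs_mul, abs_inv, hdP, hdQ]
    norm_num)
  obtain ⟨A, hA⟩ := aux_isom O hO
  have hv : 1 ≤ |((1/2 : ℝ) • (RP + O * RQ)).det| := by
    have : (1/2 : ℝ) • (RP + O * RQ) = ((1/2 : ℝ) • (RP * RQ⁻¹ + O)) * RQ := by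
      rw [Matrix.smul_mul, Matrix.add_mul, Matrix.nonsing_inv_mul_cancel_right _ _ hu]
    rw [this, Matrix.det_mul, abs_mul, hdQ, mul_one]
    exact hOdet
  obtain ⟨s, hs0, hs1, hsv⟩ := aux_scale hd _ hv
  let Φ' : C.V → EuclideanSpace ℝ (Fin d) := fun v => s • (1/2 : ℝ) • (P.Φ v + A (Q.Φ v))
  let ρ' : (Fin d → ℤ) → EuclideanSpace ℝ (Fin d) := fun a => s • (1/2 : ℝ) • (P.ρ a + A (Q.ρ a))
  have hadd : ∀ a b, ρ' (a + b) = ρ' a + ρ' b := by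
    intro a b
    simp only [ρ', P.ρ_add, Q.ρ_add, map_add]
    module
  have hvol : latVol ρ' = 1 := by
    have : (Matrix.of fun i j : Fin d => ρ' (Pi.single j 1) i) = s • (1/2 : ℝ) • (RP + O * RQ) := by
      ext i j
      simp [ρ', hA, hRP, hRQ, Matrix.mul_apply]
      ring
    rw [latVol, this, Matrix.det_smul, abs_mul, Fintype.card_fin, abs_of_pos (pow_pos hs0 d), hsv]
  let M : PeriodicRealization C :=
    { Φ := Φ', ρ := ρ', ρ_add := hadd, ρ_inj := aux_inj ρ' hadd hvol,
      equivariant := fun a v => by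
        simp only [Φ', ρ', P.equivariant, Q.equivariant, map_add]
        module }
  have h1 := hP.2 M hvol
  have h2 := hQ.2 M hvol
  let D : C.V → EuclideanSpace ℝ (Fin d) := fun v => P.Φ v - A (Q.Φ v)
  have hME : energy C M ≤ (1/2) * energy C P + (1/2) * energy C Q
      - (1/4) * ∑ e ∈ C.Erep, ‖D (C.t e) - D (C.o e)‖ ^ 2 := by
    simp only [energy, Finset.mul_sum, ← Finset.sum_add_distrib, ← Finset.sum_sub_distrib]
    refine Finset.sum_le_sum fun e _ => ?_
    set p := P.Φ (C.t e) - P.Φ (C.o e) with hp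
    set q := Q.Φ (C.t e) - Q.Φ (C.o e) with hq
    have e1 : M.Φ (C.t e) - M.Φ (C.o e) = (s * (1/2)) • (p + A q) := by
      simp only [M, Φ', hp, hq, map_sub]; module
    have e2 : D (C.t e) - D (C.o e) = p - A q := by
      simp only [D, hp, hq, map_sub]; abel
    rw [e1, e2, norm_smul, Real.norm_of_nonneg (by positivity), mul_pow]
    have e3 := parallelogram_law_with_norm ℝ p (A q)
    rw [A.norm_map] at e3
    have e4 : (s * (1/2)) ^ 2 ≤ 1/4 := by nlinarith
    nlinarith [mul_le_mul_of_nonneg_right e4 (sq_nonneg ‖p + A q‖)]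
  have hz : ∑ e ∈ C.Erep, ‖D (C.t e) - D (C.o e)‖ ^ 2 = 0 :=
    le_antisymm (by linarith) (Finset.sum_nonneg fun _ _ => by positivity)
  have hz' : ∀ e ∈ C.Erep, D (C.t e) - D (C.o e) = 0 := fun e he => by
    have := (Finset.sum_eq_zero_iff_of_nonneg (fun _ _ => by positivity)).mp hz e he
    simpa using this
  have hc := aux_const C D (fun a => P.ρ a - A (Q.ρ a)) (fun a v => by
    simp only [D, P.equivariant, Q.equivariant, map_add]; abel) hz'
  by_cases hV : Nonempty C.V
  · obtain ⟨v0⟩ := hV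
    refine ⟨A, D v0, fun v => ?_⟩
    rw [hc v0 v]
    simp [D]
  · exact ⟨A, 0, fun v => (hV ⟨v⟩).elim⟩

/-- Some realization of volume one. -/
theorem aux_nonempty {d : ℕ} (C : Crystal d) :
    ∃ P : PeriodicRealization C, latVol P.ρ = 1 := by
  choose f hf hfu using C.Vrep_spec
  let ρ : (Fin d → ℤ) → EuclideanSpace ℝ (Fin d) := fun a => WithLp.toLp 2 fun i => (a i : ℝ)
  have hadd : ∀ a b, ρ (a + b) = ρ a + ρ b := by
    intro a b; ext i; simp [ρ]
  have hvol : latVol ρ = 1 := by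
    have : (Matrix.of fun i j : Fin d => ρ (Pi.single j 1) i) = 1 := by
      ext i j
      simp [ρ, Matrix.one_apply, Pi.single_apply]
    rw [latVol, this]; simp
  refine ⟨⟨fun v => ρ (f v).1, ρ, hadd, aux_inj ρ hadd hvol, fun a v => ?_⟩, hvol⟩
  have : f (C.act a v) = (a + (f v).1, (f v).2) := by
    symm
    apply hfu
    rw [C.act_add]
    exact congrArg _ (hf v)
  rw [this]
  simp only [hadd]
  abel

/-- Normalized equivariant pairs. -/
def auxMod {d : ℕ} (C : Crystal d) (v0 : C.V) :
    Submodule ℝ ((C.V → EuclideanSpace ℝ (Fin d)) × ((Fin d → ℤ) → EuclideanSpace ℝ (Fin d))) where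
  carrier := {p | (∀ a b, p.2 (a + b) = p.2 a + p.2 b) ∧
    (∀ a v, p.1 (C.act a v) = p.1 v + p.2 a) ∧ p.1 v0 = 0}
  add_mem' := by
    rintro p q ⟨h1, h2, h3⟩ ⟨k1, k2, k3⟩
    refine ⟨fun a b => ?_, fun a v => ?_, ?_⟩
    · simp only [Prod.snd_add, Pi.add_apply, h1, k1]; abel
    · simp only [Prod.snd_add, Prod.fst_add, Pi.add_apply, h2, k2]; abel
    · simp [h3, k3]
  zero_mem' := by simp
  smul_mem' := by
    rintro c p ⟨h1, h2, h3⟩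
    refine ⟨fun a b => ?_, fun a v => ?_, ?_⟩
    · simp only [Prod.smul_snd, Pi.smul_apply, h1, smul_add]
    · simp only [Prod.smul_snd, Prod.smul_fst, Pi.smul_apply, h2, smul_add]
    · simp [h3]

def auxL {d : ℕ} (C : Crystal d) (v0 : C.V) :
    auxMod C v0 →ₗ[ℝ] PiLp 2 (fun _ : C.Erep => EuclideanSpace ℝ (Fin d)) where
  toFun p := WithLp.toLp 2 fun e => p.1.1 (C.t e.1) - p.1.1 (C.o e.1)
  map_add' p q := by
    ext1 e
    simp only [Submodule.coe_add, Prod.fst_add, Pi.add_apply, PiLp.add_apply]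
    abel
  map_smul' c p := by
    ext1 e
    simp [smul_sub]

theorem auxL_inj {d : ℕ} (C : Crystal d) (v0 : C.V) : Function.Injective (auxL C v0) := by
  rw [← LinearMap.ker_eq_bot, LinearMap.ker_eq_bot']
  rintro ⟨⟨Φ, ρ⟩, h1, h2, h3⟩ h
  simp only at h1 h2 h3
  have hc := aux_const C Φ ρ h2 (fun e he => by
    have := congrArg (fun x => x ⟨e, he⟩) h
    simpa [auxL] using this)
  have hΦ : Φ = 0 := by
    ext1 v; rw [hc v v0, h3]; rfl
  have hρ : ρ = 0 := by
    ext1 a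
    have := h2 a v0
    rw [hc _ v0] at this
    simpa using this
  subst hΦ hρ
  rfl

theorem aux_min {d : ℕ} {X Y : Type*} [AddCommGroup X] [Module ℝ X] [NormedAddCommGroup Y]
    [NormedSpace ℝ Y] [FiniteDimensional ℝ Y] (L : X →ₗ[ℝ] Y) (hL : Function.Injective L)
    (N : X →ₗ[ℝ] Matrix (Fin d) (Fin d) ℝ) (x0 : X) (hx0 : |(N x0).det| = 1) :
    ∃ x, |(N x).det| = 1 ∧ ∀ z, |(N z).det| = 1 → ‖L x‖ ≤ ‖L z‖ := by
  let φ := LinearEquiv.ofInjective L hL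
  let N' : LinearMap.range L →ₗ[ℝ] Matrix (Fin d) (Fin d) ℝ := N ∘ₗ φ.symm.toLinearMap
  have hN : Continuous N' := LinearMap.continuous_of_finiteDimensional N'
  have hN' : ∀ x, N' (φ x) = N x := fun x => by simp [N']
  have hS : IsClosed {y : LinearMap.range L | |(N' y).det| = 1} :=
    isClosed_eq (hN.matrix_det.abs) continuous_const
  have : ProperSpace (LinearMap.range L) := FiniteDimensional.proper_real _
  obtain ⟨y, hy, hmin⟩ := hS.exists_infDist_eq_dist ⟨φ x0, by simpa [hN'] using hx0⟩ 0
  obtain ⟨x, rfl⟩ := φ.surjective y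
  refine ⟨x, by simpa [hN'] using hy, fun z hz => ?_⟩
  have h1 : φ z ∈ {y : LinearMap.range L | |(N' y).det| = 1} := by simpa [hN'] using hz
  have h2 := Metric.infDist_le_dist_of_mem (x := 0) h1
  rw [hmin, dist_zero_left, dist_zero_left] at h2
  exact h2

def auxN {d : ℕ} (C : Crystal d) (v0 : C.V) : auxMod C v0 →ₗ[ℝ] Matrix (Fin d) (Fin d) ℝ where
  toFun := fun y => Matrix.of fun i j => y.1.2 (Pi.single j 1) i
  map_add' := fun x y => by ext i j; simp
  map_smul' := fun c x => by ext i j; simp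

theorem auxL_norm {d : ℕ} (C : Crystal d) (v0 : C.V) (p : auxMod C v0) :
    ‖auxL C v0 p‖ ^ 2 = ∑ e ∈ C.Erep, ‖p.1.1 (C.t e) - p.1.1 (C.o e)‖ ^ 2 := by
  rw [PiLp.norm_sq_eq_of_L2, ← Finset.sum_coe_sort C.Erep]
  rfl

theorem aux_exists {d : ℕ} (C : Crystal d) : ∃ P : PeriodicRealization C, IsStandard C P := by
  obtain ⟨P0, hP0⟩ := aux_nonempty C
  by_cases hV : Nonempty C.V
  swap
  · have hE : ∀ P : PeriodicRealization C, energy C P = 0 := fun P =>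
      Finset.sum_eq_zero fun e _ => (hV ⟨C.o e⟩).elim
    exact ⟨P0, hP0, fun Q _ => by rw [hE, hE]⟩
  obtain ⟨v0⟩ := hV
  let toM : PeriodicRealization C → auxMod C v0 := fun P =>
    ⟨(fun v => P.Φ v - P.Φ v0, P.ρ), P.ρ_add, fun a v => by
      simp only [P.equivariant]; abel, by simp⟩
  have hEn : ∀ P : PeriodicRealization C, energy C P = ‖auxL C v0 (toM P)‖ ^ 2 := fun P => by
    rw [auxL_norm, energy]
    simp [toM]
  obtain ⟨x, hx, hmin⟩ := aux_min (auxL C v0) (auxL_inj C v0) (auxN C v0) (toM P0) hP0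
  have hmem := x.2
  have hvol : latVol x.1.2 = 1 := hx
  let P : PeriodicRealization C :=
    ⟨x.1.1, x.1.2, hmem.1, aux_inj _ hmem.1 hvol, hmem.2.1⟩
  refine ⟨P, hvol, fun Q hQ => ?_⟩
  have h1 := hmin (toM Q) hQ
  have h2 : energy C P = ‖auxL C v0 x‖ ^ 2 := by rw [auxL_norm]; rfl
  rw [hEn Q, h2]
  gcongr

/-- Every topological crystal admits a standard realization, and it is
unique up to Euclidean motions of `ℝ^d` (elements of `O(d) ⋉ ℝ^d`). -/
theorem stmt4 {d : ℕ} (C : Crystal d) :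
    (∃ P : PeriodicRealization C, IsStandard C P) ∧
    (∀ P Q : PeriodicRealization C, IsStandard C P → IsStandard C Q →
      ∃ (A : EuclideanSpace ℝ (Fin d) ≃ₗᵢ[ℝ] EuclideanSpace ℝ (Fin d))
        (b : EuclideanSpace ℝ (Fin d)),
        ∀ v : C.V, P.Φ v = A (Q.Φ v) + b) := by
  exact ⟨aux_exists C, aux_unique C⟩
end
end

section
/- Let Φ be a standard realization of a d-dimensional topological crystal X in ℝ^d. Then every automorphism σ ∈ Aut(X) of the graph X extends to a Euclidean motion of ℝ^d: there exists an element g of O(d) ⋉ ℝ^d (the Euclidean motion group) such that g(Φ(v)) = Φ(σ(v)) for every vertex v of X. In particular, the standard realization has maximal symmetry among all realizations of X. -/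
noncomputable section

namespace CrystalAux

open Finset

variable {d : ℕ}

theorem conn_ind (C : Crystal d) (p : C.V → Prop) (h : ∀ e, p (C.o e) → p (C.t e))
    (u v : C.V) (hu : p u) : p v := by
  obtain ⟨L, hL, h1⟩ := C.conn u v
  rcases h1 with ⟨_, rfl⟩ | ⟨hne, h2, h3⟩
  · exact hu
  · subst h3
    have key : ∀ (L : List C.E) (hne : L ≠ []), L.IsChain (fun e f => C.t e = C.o f) →
        p (C.o (L.head hne)) → p (C.t (L.getLast hne)) := by
      intro L
      induction L with
      | nil => intro hne; exact absurd rfl hne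
      | cons a l ih =>
        intro hne hc hp
        cases l with
        | nil => simpa using h a (by simpa using hp)
        | cons b l =>
          rw [List.isChain_cons_cons] at hc
          rw [List.getLast_cons (by simp)]
          apply ih (by simp) hc.2
          simp only [List.head_cons] at hp ⊢
          rw [← hc.1]
          exact h a hp
    exact key L hne hL (h2 ▸ hu)

theorem exV (C : Crystal d) (v : C.V) : ∃ a, ∃ x ∈ C.Vrep, C.act a x = v := by
  obtain ⟨p, hp, _⟩ := C.Vrep_spec v
  exact ⟨p.1, p.2.1, p.2.2, hp⟩

theorem uniqV (C : Crystal d) {a b : Fin d → ℤ} {x y : C.V} (hx : x ∈ C.Vrep) (hy : y ∈ C.Vrep)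
    (h : C.act a x = C.act b y) : a = b ∧ x = y := by
  obtain ⟨p, _, hp⟩ := C.Vrep_spec (C.act b y)
  have h1 := hp (a, ⟨x, hx⟩) h
  have h2 := hp (b, ⟨y, hy⟩) rfl
  have h3 := h1.trans h2.symm
  simpa using h3

theorem exE (C : Crystal d) (v : C.E) : ∃ a, ∃ x ∈ C.Erep, C.acte a x = v := by
  obtain ⟨p, hp, _⟩ := C.Erep_spec v
  exact ⟨p.1, p.2.1, p.2.2, hp⟩

theorem uniqE (C : Crystal d) {a b : Fin d → ℤ} {x y : C.E} (hx : x ∈ C.Erep) (hy : y ∈ C.Erep)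
    (h : C.acte a x = C.acte b y) : a = b ∧ x = y := by
  obtain ⟨p, _, hp⟩ := C.Erep_spec (C.acte b y)
  have h1 := hp (a, ⟨x, hx⟩) h
  have h2 := hp (b, ⟨y, hy⟩) rfl
  have h3 := h1.trans h2.symm
  simpa using h3

theorem act_neg_act (C : Crystal d) (a v) : C.act (-a) (C.act a v) = v := by
  rw [← C.act_add, neg_add_cancel, C.act_zero]

theorem act_act_neg (C : Crystal d) (a v) : C.act a (C.act (-a) v) = v := by
  rw [← C.act_add, add_neg_cancel, C.act_zero]

theorem acte_neg_acte (C : Crystal d) (a v) : C.acte (-a) (C.acte a v) = v := by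
  rw [← C.acte_add, neg_add_cancel, C.acte_zero]

theorem acte_acte_neg (C : Crystal d) (a v) : C.acte a (C.acte (-a) v) = v := by
  rw [← C.acte_add, add_neg_cancel, C.acte_zero]

theorem act_inj (C : Crystal d) (v : C.V) : Function.Injective (fun a => C.act a v) := by
  intro a b h
  have h' : C.act a v = C.act b v := h
  have : C.act (-b + a) v = v := by rw [C.act_add, h', act_neg_act]
  have := C.free _ _ this
  rw [neg_add_eq_zero] at this
  exact this.symm

theorem acte_inj (C : Crystal d) (e : C.E) : Function.Injective (fun a => C.acte a e) := by
  intro a b h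
  apply act_inj C (C.o e)
  have := congrArg C.o h
  simpa [C.o_acte] using this

theorem t_bar (C : Crystal d) (e) : C.t (C.bar e) = C.o e := by
  rw [← C.o_bar, C.bar_bar]

/-- Sums over two transversals agree. -/
theorem sum_transversal (C : Crystal d) (T : Finset C.E) (F : C.E → ℝ)
    (hF : ∀ a e, F (C.acte a e) = F e)
    (hex : ∀ e, ∃ a, C.acte a e ∈ T)
    (hun : ∀ a, ∀ e ∈ T, C.acte a e ∈ T → a = 0) :
    ∑ e ∈ T, F e = ∑ e ∈ C.Erep, F e := by
  choose g r hr hgr using exE C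
  refine Finset.sum_nbij r (fun e _ => hr e) ?_ ?_ ?_
  · intro e he f hf hef
    have h1 := hgr e
    have h2 := hgr f
    have h3 : C.acte (g e + -g f) f = e := by
      rw [C.acte_add]; nth_rw 2 [← h2]; rw [acte_neg_acte, ← hef, h1]
    have := hun _ f hf (h3 ▸ he)
    rw [← h3, this, C.acte_zero]
  · intro e he
    obtain ⟨a, ha⟩ := hex e
    refine ⟨_, ha, ?_⟩
    exact (uniqE C (hr _) he (hgr _)).2
  · intro e _
    conv_lhs => rw [← hgr e, hF]

theorem sum_bar (C : Crystal d) (F : C.E → ℝ)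
    (hF : ∀ a e, F (C.acte a e) = F e) :
    ∑ e ∈ C.Erep, F (C.bar e) = ∑ e ∈ C.Erep, F e := by
  classical
  have hb : Function.Injective C.bar := fun a b h => by
    rw [← C.bar_bar a, h, C.bar_bar]
  rw [← Finset.sum_image (f := F) (g := C.bar) (fun a _ b _ h => hb h)]
  apply sum_transversal C _ F hF
  · intro e
    obtain ⟨a, x, hx, h⟩ := exE C (C.bar e)
    refine ⟨-a, Finset.mem_image.2 ⟨x, hx, ?_⟩⟩
    rw [← C.bar_bar e, ← h, C.bar_acte, acte_neg_acte]
  · intro a e he hae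
    obtain ⟨x, hx, rfl⟩ := Finset.mem_image.1 he
    obtain ⟨y, hy, h⟩ := Finset.mem_image.1 hae
    rw [← C.bar_acte] at h
    have := hb h
    have h2 : C.acte 0 y = C.acte a x := by rw [C.acte_zero, this]
    exact (uniqE C hy hx h2).1.symm

theorem sum_star (C : Crystal d) (F : C.E → ℝ)
    (hF : ∀ a e, F (C.acte a e) = F e) :
    ∑ x ∈ C.Vrep, ∑ e ∈ C.star x, F e = ∑ e ∈ C.Erep, F e := by
  classical
  rw [← Finset.sum_biUnion]
  · apply sum_transversal C _ F hF
    · intro e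
      obtain ⟨a, x, hx, h⟩ := exV C (C.o e)
      refine ⟨-a, Finset.mem_biUnion.2 ⟨x, hx, ?_⟩⟩
      rw [C.star_spec, C.o_acte, ← h, act_neg_act]
    · intro a e he hae
      obtain ⟨x, hx, h1⟩ := Finset.mem_biUnion.1 he
      obtain ⟨y, hy, h2⟩ := Finset.mem_biUnion.1 hae
      rw [C.star_spec] at h1 h2
      rw [C.o_acte, h1, ← C.act_zero y] at h2
      exact (uniqV C hx hy h2).1
  · intro x _ y _ hxy
    refine Finset.disjoint_left.2 fun e h1 h2 => hxy ?_
    rw [C.star_spec] at h1 h2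
    rw [← h1, h2]

theorem sum_star_act {M : Type*} [AddCommMonoid M] (C : Crystal d) (F : C.E → M) (a v) :
    ∑ e ∈ C.star (C.act a v), F e = ∑ e ∈ C.star v, F (C.acte a e) := by
  symm
  refine Finset.sum_nbij (C.acte a) ?_ ?_ ?_ (fun _ _ => rfl)
  · intro e he; rw [C.star_spec] at he ⊢; rw [C.o_acte, he]
  · intro e _ f _ h; rw [← acte_neg_acte C a e, h, acte_neg_acte]
  · intro e he
    refine ⟨C.acte (-a) e, ?_, acte_acte_neg C a e⟩
    have he := (C.star_spec _ _).1 he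
    exact (C.star_spec _ _).2 (by rw [C.o_acte, he, act_neg_act])

theorem sum_star_aut {M : Type*} [AddCommMonoid M] (C : Crystal d) (σV : C.V ≃ C.V) (σE : C.E ≃ C.E)
    (ho : ∀ e, C.o (σE e) = σV (C.o e)) (F : C.E → M) (v) :
    ∑ e ∈ C.star (σV v), F e = ∑ e ∈ C.star v, F (σE e) := by
  symm
  refine Finset.sum_nbij σE ?_ ?_ ?_ (fun _ _ => rfl)
  · intro e he; rw [C.star_spec] at he ⊢; rw [ho, he]
  · intro e _ f _ h; exact σE.injective h
  · intro e he
    refine ⟨σE.symm e, ?_, by simp⟩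
    have he := (C.star_spec _ _).1 he
    refine (C.star_spec _ _).2 (σV.injective ?_)
    rw [← ho]; simpa using he

/-- Harmonic functions. -/
def Harm {M : Type*} [AddCommGroup M] (C : Crystal d) (f : C.V → M) : Prop :=
  ∀ v, ∑ e ∈ C.star v, (f (C.t e) - f (C.o e)) = 0

theorem Harm.sub {M : Type*} [AddCommGroup M] {C : Crystal d} {f g : C.V → M}
    (hf : Harm C f) (hg : Harm C g) : Harm C (fun v => f v - g v) := by
  intro v
  have := congrArg₂ (· - ·) (hf v) (hg v)
  simp only [← Finset.sum_sub_distrib, sub_zero] at this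
  rw [← this]
  exact Finset.sum_congr rfl fun _ _ => sub_sub_sub_comm _ _ _ _

theorem Harm.const {M : Type*} [AddCommGroup M] {C : Crystal d} (c : M) :
    Harm C (fun _ => c) := by
  intro v; simp

theorem Harm.act {M : Type*} [AddCommGroup M] {C : Crystal d} {f : C.V → M}
    (hf : Harm C f) (a) : Harm C (fun v => f (C.act a v)) := by
  intro v
  have := hf (C.act a v)
  rw [sum_star_act] at this
  simpa [C.o_acte, C.t_acte] using this

theorem Harm.map {M N : Type*} [AddCommGroup M] [AddCommGroup N] {C : Crystal d} {f : C.V → M}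
    (hf : Harm C f) (φ : M →+ N) : Harm C (fun v => φ (f v)) := by
  intro v
  have := congrArg φ (hf v)
  simpa using this

theorem harnack (C : Crystal d) (u v : C.V) : ∃ K : ℝ, 0 ≤ K ∧ ∀ w : C.V → ℝ, Harm C w →
    (∀ x, 0 ≤ w x) → w v ≤ K * w u := by
  apply conn_ind C (fun v => ∃ K : ℝ, 0 ≤ K ∧ ∀ w : C.V → ℝ, Harm C w →
    (∀ x, 0 ≤ w x) → w v ≤ K * w u) ?_ u v
  · exact ⟨1, by norm_num, fun w _ _ => by simp⟩
  · rintro e ⟨K, hK, h⟩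
    refine ⟨(C.star (C.o e)).card * K, by positivity, fun w hw hp => ?_⟩
    have h1 := hw (C.o e)
    have h2 : ∑ f ∈ C.star (C.o e), w (C.t f) = (C.star (C.o e)).card * w (C.o e) := by
      rw [Finset.sum_sub_distrib, sub_eq_zero] at h1
      rw [h1, ← nsmul_eq_mul, ← Finset.sum_const]
      exact Finset.sum_congr rfl fun f hf => by rw [(C.star_spec _ _).1 hf]
    have h3 : w (C.t e) ≤ ∑ f ∈ C.star (C.o e), w (C.t f) :=
      Finset.single_le_sum (f := fun f => w (C.t f)) (fun f _ => hp _) ((C.star_spec _ _).2 rfl)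
    rw [h2] at h3
    have := mul_le_mul_of_nonneg_left (h w hw hp) (Nat.cast_nonneg (α := ℝ) (C.star (C.o e)).card)
    linarith

theorem harnack_act (C : Crystal d) (g : Fin d → ℤ) : ∃ K : ℝ, 0 ≤ K ∧ ∀ w : C.V → ℝ, Harm C w →
    (∀ x, 0 ≤ w x) → ∀ v, w (C.act g v) ≤ K * w v := by
  choose K hK h using fun v => harnack C v (C.act g v)
  refine ⟨∑ x ∈ C.Vrep, K x, Finset.sum_nonneg fun x _ => hK x, fun w hw hp v => ?_⟩
  obtain ⟨a, x, hx, rfl⟩ := exV C v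
  have h1 := h x _ (hw.act a) (fun _ => hp _)
  rw [← C.act_add, add_comm, C.act_add] at h1
  refine h1.trans (mul_le_mul_of_nonneg_right ?_ (hp _))
  exact Finset.single_le_sum (fun y _ => hK y) hx

theorem liouville_le (C : Crystal d) (h : C.V → ℝ) (hh : Harm C h) (B : ℝ) (hB : ∀ v, |h v| ≤ B)
    (g : Fin d → ℤ) (v : C.V) : h (C.act g v) ≤ h v := by
  obtain ⟨K, hK, hKw⟩ := harnack_act C g
  have : Nonempty C.V := ⟨v⟩
  set D : C.V → ℝ := fun v => h (C.act g v) - h v with hD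
  have hbdd : BddAbove (Set.range D) := ⟨2 * B, by
    rintro _ ⟨x, rfl⟩
    have h1 := abs_le.1 (hB (C.act g x))
    have h2 := abs_le.1 (hB x)
    simp only [hD]; linarith⟩
  set M := ⨆ x, D x with hM
  have hDM : ∀ x, D x ≤ M := fun x => le_ciSup hbdd x
  suffices hM0 : M ≤ 0 by
    have := hDM v
    simp only [hD] at this; linarith
  have hw : Harm C (fun x => M - D x) := (Harm.const M).sub ((hh.act g).sub hh)
  have hw0 : ∀ x, 0 ≤ M - D x := fun x => by linarith [hDM x]
  have step : ∀ n : ℕ, ∀ x, M - D ((C.act g)^[n] x) ≤ K ^ n * (M - D x) := by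
    intro n
    induction n with
    | zero => intro x; simp
    | succ n ih =>
      intro x
      rw [Function.iterate_succ_apply', pow_succ']
      refine (hKw _ hw hw0 _).trans ?_
      rw [mul_assoc]
      exact mul_le_mul_of_nonneg_left (ih x) hK
  have tel : ∀ n : ℕ, ∀ x, n * M - (∑ k ∈ range n, K ^ k) * (M - D x) ≤
      h ((C.act g)^[n] x) - h x := by
    intro n
    induction n with
    | zero => intro x; simp
    | succ n ih =>
      intro x
      have h1 := ih x
      have h2 := step n x
      rw [Function.iterate_succ_apply', Finset.sum_range_succ]
      have h3 : D ((C.act g)^[n] x) = h (C.act g ((C.act g)^[n] x)) - h ((C.act g)^[n] x) := rfl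
      push_cast
      nlinarith
  have fin : ∀ n : ℕ, n * M ≤ 2 * B := by
    intro n
    by_contra hcon
    push Not at hcon
    set S := ∑ k ∈ range n, K ^ k with hS
    have hS0 : 0 ≤ S := Finset.sum_nonneg fun k _ => pow_nonneg hK k
    have hε : 0 < (n * M - 2 * B) / (S + 1) := by apply div_pos <;> linarith
    obtain ⟨x, hx⟩ := exists_lt_of_lt_ciSup (show M - (n * M - 2 * B) / (S + 1) < ⨆ x, D x by linarith)
    have h1 := tel n x
    rw [← hS] at h1
    have h2 := abs_le.1 (hB ((C.act g)^[n] x))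
    have h3 := abs_le.1 (hB x)
    have h4 : M - D x < (n * M - 2 * B) / (S + 1) := by linarith
    rw [lt_div_iff₀ (by linarith)] at h4
    have := hw0 x
    nlinarith
  by_contra hpos
  push Not at hpos
  obtain ⟨n, hn⟩ := exists_nat_gt (2 * B / M)
  rw [div_lt_iff₀ hpos] at hn
  exact absurd (fin n) (not_le.2 hn)

theorem periodic_const (C : Crystal d) (h : C.V → ℝ) (hh : Harm C h)
    (hp : ∀ a v, h (C.act a v) = h v) (u v : C.V) : h u = h v := by
  have hne : C.Vrep.Nonempty := by
    obtain ⟨a, x, hx, _⟩ := exV C u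
    exact ⟨x, hx⟩
  obtain ⟨m, hm, hmax⟩ := C.Vrep.exists_max_image h hne
  have hle : ∀ x, h x ≤ h m := by
    intro x
    obtain ⟨a, y, hy, rfl⟩ := exV C x
    rw [hp]; exact hmax y hy
  have : ∀ x, h x = h m := by
    intro x
    obtain ⟨K, hK, h1⟩ := harnack C m x
    have := h1 _ ((Harm.const (h m)).sub hh) (fun y => by linarith [hle y])
    simp only [sub_self, mul_zero] at this
    linarith [hle x]
  rw [this u, this v]

theorem liouville (C : Crystal d) (h : C.V → ℝ) (hh : Harm C h) (B : ℝ) (hB : ∀ v, |h v| ≤ B)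
    (u v : C.V) : h u = h v := by
  refine periodic_const C h hh (fun a v => le_antisymm (liouville_le C h hh B hB a v) ?_) u v
  have := liouville_le C h hh B hB (-a) (C.act a v)
  rwa [act_neg_act] at this

/-- Edge vector. -/
def ev {C : Crystal d} (P : PeriodicRealization C) (e : C.E) : EuclideanSpace ℝ (Fin d) :=
  P.Φ (C.t e) - P.Φ (C.o e)

theorem ev_acte {C : Crystal d} (P : PeriodicRealization C) (a e) : ev P (C.acte a e) = ev P e := by
  simp [ev, C.o_acte, C.t_acte, P.equivariant]

theorem ev_bar {C : Crystal d} (P : PeriodicRealization C) (e) : ev P (C.bar e) = - ev P e := by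
  simp [ev, C.o_bar, t_bar]

theorem quad_zero (a b : ℝ) (h : ∀ s : ℝ, 0 ≤ s * a + s ^ 2 * b) : a = 0 := by
  by_contra ha
  have hb : 0 < |b| + 1 := by positivity
  have h1 := h (-a / (|b| + 1))
  have h2 : (-a / (|b| + 1)) * a + (-a / (|b| + 1)) ^ 2 * b =
      (a ^ 2 / (|b| + 1) ^ 2) * (b - (|b| + 1)) := by
    field_simp; ring
  rw [h2] at h1
  have h3 : 0 < a ^ 2 / (|b| + 1) ^ 2 := by positivity
  have := le_abs_self b
  nlinarith

theorem first_variation {C : Crystal d} {P : PeriodicRealization C} (hP : IsStandard C P)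
    (Q : ℝ → PeriodicRealization C) (hQ : ∀ s, latVol (Q s).ρ = 1)
    (δ : C.E → EuclideanSpace ℝ (Fin d)) (hδ : ∀ s e, ev (Q s) e = ev P e + s • δ e) :
    ∑ e ∈ C.Erep, inner ℝ (ev P e) (δ e) = 0 := by
  have key := quad_zero (2 * ∑ e ∈ C.Erep, inner ℝ (ev P e) (δ e)) (∑ e ∈ C.Erep, ‖δ e‖ ^ 2) ?_
  · linarith
  · intro s
    have h1 := hP.2 (Q s) (hQ s)
    have h2 : energy C (Q s) = energy C P + (s * (2 * ∑ e ∈ C.Erep, inner ℝ (ev P e) (δ e)) +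
        s ^ 2 * ∑ e ∈ C.Erep, ‖δ e‖ ^ 2) := by
      unfold energy
      simp only [Finset.mul_sum, ← Finset.sum_add_distrib]
      refine Finset.sum_congr rfl fun e _ => ?_
      have := hδ s e
      simp only [ev] at this ⊢
      rw [this, norm_add_sq_real, norm_smul, inner_smul_right, mul_pow, Real.norm_eq_abs, sq_abs]
      ring
    linarith

/-- The tension vector field. -/
def tens {C : Crystal d} (P : PeriodicRealization C) (v : C.V) : EuclideanSpace ℝ (Fin d) :=
  ∑ e ∈ C.star v, ev P e

theorem tens_act {C : Crystal d} (P : PeriodicRealization C) (a v) :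
    tens P (C.act a v) = tens P v := by
  unfold tens
  rw [sum_star_act]
  simp [ev_acte]

theorem standard_harm {C : Crystal d} {P : PeriodicRealization C} (hP : IsStandard C P) :
    Harm C P.Φ := by
  have h1 := first_variation hP
    (fun s => { Φ := fun v => P.Φ v + s • tens P v
                ρ := P.ρ
                ρ_add := P.ρ_add
                ρ_inj := P.ρ_inj
                equivariant := fun a v => by rw [tens_act, P.equivariant]; abel })
    (fun s => hP.1) (fun e => tens P (C.t e) - tens P (C.o e))
    (fun s e => by simp only [ev, smul_sub]; abel)
  have hinv : ∀ a e, inner ℝ (ev P (C.acte a e)) (tens P (C.o (C.acte a e))) =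
      inner ℝ (ev P e) (tens P (C.o e)) := by
    intro a e; rw [ev_acte, C.o_acte, tens_act]
  have h2 := sum_bar C (fun e => inner ℝ (ev P e) (tens P (C.o e))) hinv
  have h3 := sum_star C (fun e => inner ℝ (ev P e) (tens P (C.o e))) hinv
  have h4 : ∑ x ∈ C.Vrep, ∑ e ∈ C.star x, inner ℝ (ev P e) (tens P (C.o e)) =
      ∑ x ∈ C.Vrep, ‖tens P x‖ ^ 2 := by
    refine Finset.sum_congr rfl fun x _ => ?_
    rw [← real_inner_self_eq_norm_sq]
    conv_rhs => enter [2]; rw [tens]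
    rw [sum_inner]
    exact Finset.sum_congr rfl fun e he => by rw [(C.star_spec _ _).1 he]
  simp only [ev_bar, C.o_bar, inner_neg_left, Finset.sum_neg_distrib] at h2
  simp only [inner_sub_right, Finset.sum_sub_distrib] at h1
  have h5 : ∑ x ∈ C.Vrep, ‖tens P x‖ ^ 2 = 0 := by linarith
  rw [Finset.sum_eq_zero_iff_of_nonneg (fun _ _ => by positivity)] at h5
  intro v
  obtain ⟨a, x, hx, rfl⟩ := exV C v
  have h6 := h5 x hx
  have h7 : tens P x = 0 := by simpa using h6
  have h8 := tens_act P a x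
  rw [h7] at h8
  exact h8

theorem latVol_shear (ρ : (Fin d → ℤ) → EuclideanSpace ℝ (Fin d))
    (u w : EuclideanSpace ℝ (Fin d)) (huw : inner ℝ w u = 0) (s : ℝ) :
    latVol (fun a => ρ a + s • (inner ℝ w (ρ a) • u)) = latVol ρ := by
  unfold latVol
  have h : (Matrix.of fun i j : Fin d => (ρ (Pi.single j 1) + s • (inner ℝ w (ρ (Pi.single j 1)) • u)) i)
      = (1 + Matrix.replicateCol Unit (s • (u : Fin d → ℝ)) * Matrix.replicateRow Unit (w : Fin d → ℝ)) *
        (Matrix.of fun i j : Fin d => ρ (Pi.single j 1) i) := by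
    ext i j
    rw [add_mul, one_mul, Matrix.add_apply, Matrix.mul_assoc, Matrix.mul_apply]
    simp [Matrix.mul_apply, PiLp.inner_apply, Finset.sum_mul, Finset.mul_sum]
    exact Finset.sum_congr rfl fun _ _ => by ring
  rw [h, Matrix.det_mul, Matrix.det_one_add_replicateCol_mul_replicateRow]
  have : (w : Fin d → ℝ) ⬝ᵥ (s • (u : Fin d → ℝ)) = 0 := by
    rw [dotProduct_smul]
    have : (w : Fin d → ℝ) ⬝ᵥ (u : Fin d → ℝ) = inner ℝ w u := by
      simp [dotProduct, PiLp.inner_apply, mul_comm]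
    rw [this, huw, smul_zero]
  rw [this]; simp

theorem standard_tight {C : Crystal d} {P : PeriodicRealization C} (hP : IsStandard C P)
    (u w : EuclideanSpace ℝ (Fin d)) (huw : inner ℝ w u = 0) :
    ∑ e ∈ C.Erep, inner ℝ w (ev P e) * inner ℝ u (ev P e) = 0 := by
  have h1 := first_variation hP
    (fun s => { Φ := fun v => P.Φ v + s • (inner ℝ w (P.Φ v) • u)
                ρ := fun a => P.ρ a + s • (inner ℝ w (P.ρ a) • u)
                ρ_add := fun a b => by
                  rw [P.ρ_add, inner_add_right, add_smul, smul_add]; abel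
                ρ_inj := fun a b hab => by
                  apply P.ρ_inj
                  have h2 := congrArg (fun z => inner ℝ w z) hab
                  simp only [inner_add_right, inner_smul_right, huw, mul_zero, add_zero] at h2
                  simp only [h2] at hab
                  exact add_right_cancel hab
                equivariant := fun a v => by
                  rw [P.equivariant, inner_add_right, add_smul, smul_add]; abel })
    (fun s => (latVol_shear P.ρ u w huw s).trans hP.1) (fun e => inner ℝ w (ev P e) • u)
    (fun s e => by simp only [ev, inner_sub_right, sub_smul, smul_sub]; abel)
  rw [← h1]
  exact Finset.sum_congr rfl fun e _ => by rw [inner_smul_right, real_inner_comm u]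

/-- The quadratic form of the edge vectors. -/
def qf {C : Crystal d} (P : PeriodicRealization C) (w : EuclideanSpace ℝ (Fin d)) : ℝ :=
  ∑ e ∈ C.Erep, (inner ℝ w (ev P e)) ^ 2

theorem qf_eq {C : Crystal d} {P : PeriodicRealization C} (hP : IsStandard C P)
    (u w : EuclideanSpace ℝ (Fin d)) : ‖w‖ ^ 2 * qf P u = ‖u‖ ^ 2 * qf P w := by
  have h := standard_tight hP (‖w‖ • u + ‖u‖ • w) (‖w‖ • u - ‖u‖ • w) (by
    simp only [inner_sub_left, inner_add_right, inner_smul_left, inner_smul_right,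
      real_inner_self_eq_norm_sq, real_inner_comm w u]
    simp; ring)
  rw [qf, qf, Finset.mul_sum, Finset.mul_sum, ← sub_eq_zero, ← Finset.sum_sub_distrib, ← h]
  refine Finset.sum_congr rfl fun e _ => ?_
  simp only [inner_sub_left, inner_add_left, inner_smul_left]
  simp; ring

theorem qf_pos {C : Crystal d} {P : PeriodicRealization C} (hP : IsStandard C P) (hd : 0 < d)
    (v₀ : C.V) : ∃ c : ℝ, 0 < c ∧ ∀ w, qf P w = c * ‖w‖ ^ 2 := by
  have : Nonempty (Fin d) := ⟨⟨0, hd⟩⟩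
  obtain ⟨z, hz⟩ := exists_norm_eq (EuclideanSpace ℝ (Fin d)) (zero_le_one)
  refine ⟨qf P z, ?_, fun w => by have := qf_eq hP w z; rw [hz] at this; linarith⟩
  have h0 : 0 ≤ qf P z := Finset.sum_nonneg fun _ _ => sq_nonneg _
  refine lt_of_le_of_ne h0 fun hc => ?_
  have hall : ∀ w, qf P w = 0 := fun w => by
    have := qf_eq hP w z; rw [hz, ← hc] at this; linarith
  have hev : ∀ e, ev P e = 0 := by
    intro e
    obtain ⟨a, x, hx, rfl⟩ := exE C e
    rw [ev_acte]
    have h1 := hall (ev P x)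
    rw [qf, Finset.sum_eq_zero_iff_of_nonneg (fun _ _ => sq_nonneg _)] at h1
    have h2 := h1 x hx
    simpa using h2
  have hconst : ∀ v, P.Φ v = P.Φ v₀ := fun v =>
    conn_ind C (fun v => P.Φ v = P.Φ v₀) (fun e he => by
      have := hev e
      rw [ev, sub_eq_zero] at this
      rw [this, he]) v₀ v rfl
  have hρ : ∀ a, P.ρ a = 0 := fun a => by
    have := P.equivariant a v₀
    rw [hconst] at this
    simpa using this
  have h1 : (1 : Fin d → ℤ) = 0 := P.ρ_inj ((hρ 1).trans (hρ 0).symm)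
  have := congrFun h1 ⟨0, hd⟩
  simp at this

theorem lip_path (C : Crystal d) (B : ℝ) (u v : C.V) : ∃ K : ℝ, 0 ≤ K ∧
    ∀ f : C.V → EuclideanSpace ℝ (Fin d), (∀ e, ‖f (C.t e) - f (C.o e)‖ ≤ B) →
      ‖f v - f u‖ ≤ K := by
  apply conn_ind C (fun v => ∃ K : ℝ, 0 ≤ K ∧
    ∀ f : C.V → EuclideanSpace ℝ (Fin d), (∀ e, ‖f (C.t e) - f (C.o e)‖ ≤ B) →
      ‖f v - f u‖ ≤ K) ?_ u v
  · exact ⟨0, le_rfl, fun f _ => by simp⟩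
  · rintro e ⟨K, hK, h⟩
    refine ⟨K + |B|, by positivity, fun f hf => ?_⟩
    have h1 := h f hf
    have h2 := hf e
    have h3 := norm_add_le (f (C.o e) - f u) (f (C.t e) - f (C.o e))
    rw [show f (C.o e) - f u + (f (C.t e) - f (C.o e)) = f (C.t e) - f u by abel] at h3
    linarith [le_abs_self B]

theorem lip_act (C : Crystal d) (B : ℝ) (f : C.V → EuclideanSpace ℝ (Fin d))
    (hf : ∀ e, ‖f (C.t e) - f (C.o e)‖ ≤ B) (g : Fin d → ℤ) :
    ∃ K : ℝ, ∀ v, ‖f (C.act g v) - f v‖ ≤ K := by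
  choose K hK h using fun v => lip_path C B v (C.act g v)
  refine ⟨∑ x ∈ C.Vrep, K x, fun v => ?_⟩
  obtain ⟨a, x, hx, rfl⟩ := exV C v
  have h1 := h x (fun v => f (C.act a v)) (fun e => by
    rw [← C.o_acte, ← C.t_acte]; exact hf _)
  rw [← C.act_add, add_comm, C.act_add] at h1
  exact h1.trans (Finset.single_le_sum (fun y _ => hK y) hx)

theorem affine {C : Crystal d} {P : PeriodicRealization C} (hP : IsStandard C P) (hd : 0 < d)
    (v₀ : C.V) (f : C.V → EuclideanSpace ℝ (Fin d)) (hf : Harm C f) (B : ℝ)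
    (hB : ∀ e, ‖f (C.t e) - f (C.o e)‖ ≤ B) :
    ∃ (L : EuclideanSpace ℝ (Fin d) →ₗ[ℝ] EuclideanSpace ℝ (Fin d))
      (b : EuclideanSpace ℝ (Fin d)), ∀ v, f v = L (P.Φ v) + b := by
  have hne : Nonempty (Fin d) := ⟨⟨0, hd⟩⟩
  let coord : Fin d → (EuclideanSpace ℝ (Fin d) →+ ℝ) := fun i =>
    { toFun := fun x => x i, map_zero' := rfl, map_add' := fun _ _ => rfl }
  let τ : (Fin d → ℤ) → EuclideanSpace ℝ (Fin d) := fun a => f (C.act a v₀) - f v₀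
  have hτ : ∀ a v, f (C.act a v) = f v + τ a := by
    intro a v
    obtain ⟨K, hK⟩ := lip_act C B f hB a
    have hD : Harm C (fun v => f (C.act a v) - f v) := (hf.act a).sub hf
    have : f (C.act a v) - f v = f (C.act a v₀) - f v₀ := by
      ext i
      refine liouville C _ (hD.map (coord i)) K (fun x => ?_) v v₀
      exact (PiLp.norm_apply_le (f (C.act a x) - f x) i).trans (hK x)
    simp only [τ]
    rw [← this]; abel
  have hτ_add : ∀ a b, τ (a + b) = τ a + τ b := by
    intro a b
    have h1 := hτ (a + b) v₀
    rw [C.act_add, hτ, hτ] at h1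
    rw [add_assoc] at h1
    rw [← add_left_cancel h1, add_comm]
  have hdet : IsUnit (Matrix.of fun i j : Fin d => P.ρ (Pi.single j 1) i) := by
    rw [Matrix.isUnit_iff_isUnit_det, isUnit_iff_ne_zero]
    intro h0
    have := hP.1
    unfold latVol at this
    rw [h0] at this
    simp at this
  have hli : LinearIndependent ℝ (fun j : Fin d => P.ρ (Pi.single j 1)) := by
    have := Matrix.linearIndependent_cols_iff_isUnit.2 hdet
    exact LinearIndependent.of_comp (WithLp.linearEquiv 2 ℝ (Fin d → ℝ)).toLinearMap this
  let bs := basisOfLinearIndependentOfCardEqFinrank hli (by simp)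
  let L := bs.constr ℝ (fun j => τ (Pi.single j 1))
  have hL : ∀ j, L (P.ρ (Pi.single j 1)) = τ (Pi.single j 1) := by
    intro j
    have := bs.constr_basis ℝ (fun j => τ (Pi.single j 1)) j
    have hbj : bs j = P.ρ (Pi.single j 1) := by
      simp only [bs, coe_basisOfLinearIndependentOfCardEqFinrank]
    rw [hbj] at this
    exact this
  let φ₁ : (Fin d → ℤ) →+ EuclideanSpace ℝ (Fin d) := AddMonoidHom.mk' (fun a => L (P.ρ a))
    (fun a b => by rw [P.ρ_add, map_add])
  let φ₂ : (Fin d → ℤ) →+ EuclideanSpace ℝ (Fin d) := AddMonoidHom.mk' τ hτ_add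
  have hφ : φ₁ = φ₂ := by
    ext1 i
    apply AddMonoidHom.ext_int
    exact hL i
  have hLρ : ∀ a, L (P.ρ a) = τ a := fun a => DFunLike.congr_fun hφ a
  refine ⟨L, f v₀ - L (P.Φ v₀), fun v => ?_⟩
  have hh : Harm C (fun v => f v - L (P.Φ v)) :=
    hf.sub ((standard_harm hP).map L.toAddMonoidHom)
  have : f v - L (P.Φ v) = f v₀ - L (P.Φ v₀) := by
    ext i
    refine periodic_const C _ (hh.map (coord i)) (fun a x => ?_) v v₀
    rw [hτ, P.equivariant, map_add, hLρ, add_sub_add_right_eq_sub]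
  rw [← this]; abel

/-- Boundary edges of a finite set of vertices. -/
def bd (C : Crystal d) (S : Finset C.V) : Finset C.E := by
  classical exact (S.biUnion C.star).filter (fun e => C.t e ∉ S)

theorem mem_bd (C : Crystal d) (S : Finset C.V) (e) : e ∈ bd C S ↔ C.o e ∈ S ∧ C.t e ∉ S := by
  classical
  simp [bd, C.star_spec]

/-- Number of points of the orbit of `x` in `S`. -/
def cnt (C : Crystal d) (S : Finset C.V) (x : C.V) : Finset (Fin d → ℤ) :=
  S.preimage (fun a => C.act a x) (act_inj C x).injOn

theorem mem_cnt (C : Crystal d) (S : Finset C.V) (x a) : a ∈ cnt C S x ↔ C.act a x ∈ S := by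
  simp [cnt]

theorem cnt_le (C : Crystal d) (x y : C.V) : ∃ K : ℕ, ∀ S : Finset C.V,
    (cnt C S x).card ≤ (cnt C S y).card + K * (bd C S).card := by
  classical
  apply conn_ind C (fun y => ∃ K : ℕ, ∀ S : Finset C.V,
    (cnt C S x).card ≤ (cnt C S y).card + K * (bd C S).card) ?_ x y
  · exact ⟨0, fun S => by simp⟩
  · rintro e ⟨K, hK⟩
    refine ⟨K + 1, fun S => ?_⟩
    have h1 : cnt C S (C.o e) ⊆ cnt C S (C.t e) ∪
        (bd C S).preimage (fun a => C.acte a e) (acte_inj C e).injOn := by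
      intro a ha
      rw [mem_cnt] at ha
      rw [Finset.mem_union, mem_cnt, Finset.mem_preimage, mem_bd, C.o_acte, C.t_acte]
      tauto
    have h2 := (Finset.card_le_card h1).trans (Finset.card_union_le _ _)
    have h3 : ((bd C S).preimage (fun a => C.acte a e) (acte_inj C e).injOn).card ≤ (bd C S).card :=
      Finset.card_le_card_of_injOn (fun a => C.acte a e)
        (fun a ha => by simpa using ha) (acte_inj C e).injOn
    have h4 := hK S
    rw [add_mul, one_mul]
    omega

theorem sum_cnt (C : Crystal d) (S : Finset C.V) (ψ : C.V → ℝ)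
    (hψ : ∀ a v, ψ (C.act a v) = ψ v) :
    ∑ v ∈ S, ψ v = ∑ x ∈ C.Vrep, (cnt C S x).card * ψ x := by
  classical
  choose g r hr hgr using exV C
  rw [← Finset.sum_fiberwise_of_maps_to (g := r) (t := C.Vrep) (fun v _ => hr v)]
  refine Finset.sum_congr rfl fun x hx => ?_
  rw [← nsmul_eq_mul, ← Finset.sum_const]
  symm
  refine Finset.sum_nbij (fun a => C.act a x) ?_ (act_inj C x).injOn ?_ ?_
  · intro a ha
    rw [mem_cnt] at ha
    rw [Finset.mem_filter]
    exact ⟨ha, (uniqV C (hr _) hx (hgr _)).2⟩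
  · intro v hv
    rw [Finset.mem_coe, Finset.mem_filter] at hv
    have := hgr v
    rw [hv.2] at this
    refine ⟨g v, ?_, this⟩
    rw [Finset.mem_coe, mem_cnt, this]; exact hv.1
  · intro a _
    rw [hψ]

theorem equidist (C : Crystal d) : ∃ K : ℝ, 0 ≤ K ∧ ∀ (S : Finset C.V) (ψ : C.V → ℝ),
    (∀ v, 0 ≤ ψ v) → (∀ a v, ψ (C.act a v) = ψ v) →
    |C.Vrep.card * ∑ v ∈ S, ψ v - S.card * ∑ x ∈ C.Vrep, ψ x| ≤
      K * (bd C S).card * ∑ x ∈ C.Vrep, ψ x := by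
  choose K hK using cnt_le C
  set K' : ℝ := ∑ x ∈ C.Vrep, ∑ y ∈ C.Vrep, ((K x y : ℝ) + K y x) with hK'
  refine ⟨K', Finset.sum_nonneg fun _ _ => Finset.sum_nonneg fun _ _ => by positivity,
    fun S ψ hψ0 hψ => ?_⟩
  have hS : (S.card : ℝ) = ∑ y ∈ C.Vrep, ((cnt C S y).card : ℝ) := by
    have := sum_cnt C S (fun _ => 1) (fun _ _ => rfl)
    simpa using this
  have hb : ∀ x ∈ C.Vrep, |(C.Vrep.card : ℝ) * (cnt C S x).card - S.card| ≤ K' * (bd C S).card := by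
    intro x hx
    rw [hS, ← nsmul_eq_mul, ← Finset.sum_const, ← Finset.sum_sub_distrib]
    refine (Finset.abs_sum_le_sum_abs _ _).trans ?_
    have h1 : ∀ y ∈ C.Vrep, |((cnt C S x).card : ℝ) - (cnt C S y).card| ≤
        ((K x y : ℝ) + K y x) * (bd C S).card := by
      intro y _
      have h2 : ((cnt C S x).card : ℝ) ≤ (cnt C S y).card + K x y * (bd C S).card := by
        exact_mod_cast hK x y S
      have h3 : ((cnt C S y).card : ℝ) ≤ (cnt C S x).card + K y x * (bd C S).card := by
        exact_mod_cast hK y x S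
      have h4 : (0 : ℝ) ≤ K x y * (bd C S).card := by positivity
      have h5 : (0 : ℝ) ≤ K y x * (bd C S).card := by positivity
      rw [abs_le, add_mul]
      constructor <;> linarith
    refine (Finset.sum_le_sum h1).trans ?_
    rw [← Finset.sum_mul]
    refine mul_le_mul_of_nonneg_right ?_ (by positivity)
    exact Finset.single_le_sum (f := fun x => ∑ y ∈ C.Vrep, ((K x y : ℝ) + K y x))
      (fun _ _ => Finset.sum_nonneg fun _ _ => by positivity) hx
  rw [sum_cnt C S ψ hψ, Finset.mul_sum, Finset.mul_sum, ← Finset.sum_sub_distrib, Finset.mul_sum]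
  refine (Finset.abs_sum_le_sum_abs _ _).trans (Finset.sum_le_sum fun x hx => ?_)
  rw [← mul_assoc, ← sub_mul, abs_mul, abs_of_nonneg (hψ0 x)]
  exact mul_le_mul_of_nonneg_right (hb x hx) (hψ0 x)

theorem folner (C : Crystal d) (v₀ : C.V) (ε : ℝ) (hε : 0 < ε) :
    ∃ S : Finset C.V, 0 < S.card ∧ ((bd C S).card : ℝ) ≤ ε * S.card := by
  classical
  choose g r hr hgr using exV C
  choose ge re hre hgre using exE C
  -- bound for the coordinates of all relevant translations
  obtain ⟨k, hk⟩ : ∃ k : ℕ, ∀ e ∈ C.Erep, ∀ i, |g (C.t e) i - g (C.o e) i| ≤ k := by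
    refine ⟨∑ e ∈ C.Erep, ∑ i, (g (C.t e) i - g (C.o e) i).natAbs, fun e he i => ?_⟩
    rw [Int.abs_eq_natAbs]
    norm_cast
    refine le_trans ?_ (Finset.single_le_sum
      (f := fun e => ∑ i, (g (C.t e) i - g (C.o e) i).natAbs) (fun _ _ => Nat.zero_le _) he)
    exact Finset.single_le_sum
      (f := fun i => (g (C.t e) i - g (C.o e) i).natAbs) (fun _ _ => Nat.zero_le _)
      (Finset.mem_univ i)
  let box : ℕ → Finset (Fin d → ℤ) := fun n => Fintype.piFinset fun _ => Finset.Ico 0 (n : ℤ)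
  let inn : ℕ → Finset (Fin d → ℤ) := fun n =>
    Fintype.piFinset fun _ => Finset.Ico (k : ℤ) ((n : ℤ) - k)
  have hbox : ∀ n, (box n).card = n ^ d := fun n => by simp [box]
  have hinn : ∀ n, (inn n).card = (n - 2 * k) ^ d := fun n => by
    simp only [inn, Fintype.card_piFinset_const, Int.card_Ico]
    congr 1; omega
  have hsub : ∀ n, inn n ⊆ box n := by
    intro n a ha
    simp only [inn, box, Fintype.mem_piFinset, Finset.mem_Ico] at ha ⊢
    intro i; have := ha i; omega
  let F : ℕ → Finset C.V := fun n => (box n ×ˢ C.Vrep).image (fun p => C.act p.1 p.2)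
  have hF : ∀ n, (F n).card = n ^ d * C.Vrep.card := by
    intro n
    simp only [F]
    rw [Finset.card_image_of_injOn, Finset.card_product, hbox]
    rintro ⟨a, x⟩ hp ⟨b, y⟩ hq h
    simp only [Finset.mem_coe, Finset.mem_product] at hp hq
    have := uniqV C hp.2 hq.2 h
    exact Prod.ext this.1 this.2
  have hmem : ∀ n a v, C.act a v ∈ F n ↔ a + g v ∈ box n := by
    intro n a v
    simp only [F, Finset.mem_image, Finset.mem_product, Prod.exists]
    constructor
    · rintro ⟨b, x, ⟨hb, hx⟩, h⟩
      rw [← hgr v, ← C.act_add] at h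
      rw [← (uniqV C hx (hr v) h).1]; exact hb
    · intro h
      exact ⟨a + g v, r v, ⟨h, hr v⟩, by rw [C.act_add, hgr]⟩
  have hbd : ∀ n, (bd C (F n)).card ≤ C.Erep.card * (n ^ d - (n - 2 * k) ^ d) := by
    intro n
    have h1 : bd C (F n) ⊆ (C.Erep ×ˢ (box n \ inn n)).image
        (fun p => C.acte (p.2 - g (C.o p.1)) p.1) := by
      intro e he
      rw [mem_bd, ← hgre e, C.o_acte, C.t_acte, hmem, hmem] at he
      refine Finset.mem_image.2 ⟨(re e, ge e + g (C.o (re e))), ?_, by simp [hgre]⟩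
      rw [Finset.mem_product, Finset.mem_sdiff]
      refine ⟨hre e, he.1, fun hin => he.2 ?_⟩
      simp only [inn, box, Fintype.mem_piFinset, Finset.mem_Ico, Pi.add_apply] at hin ⊢
      intro i
      have h2 := hin i
      have h3 := abs_le.1 (hk _ (hre e) i)
      omega
    refine (Finset.card_le_card h1).trans (Finset.card_image_le.trans ?_)
    rw [Finset.card_product, Finset.card_sdiff_of_subset (hsub n), hbox, hinn]
  have hlim : Filter.Tendsto (fun n : ℕ => (C.Erep.card : ℝ) * (1 - (1 - (2 * k : ℝ) / n) ^ d))
      Filter.atTop (nhds 0) := by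
    have h1 := tendsto_const_div_atTop_nhds_zero_nat (2 * k : ℝ)
    have h2 := ((h1.const_sub 1).pow d).const_sub 1
    simpa using h2.const_mul (C.Erep.card : ℝ)
  obtain ⟨n, hn1, hn2⟩ := ((hlim.eventually (gt_mem_nhds hε)).and
    (Filter.eventually_ge_atTop (2 * k + 1))).exists
  have hV : 1 ≤ C.Vrep.card := Finset.card_pos.2 ⟨_, hr v₀⟩
  have hn0 : 0 < n := by omega
  refine ⟨F n, by rw [hF]; positivity, ?_⟩
  have hnR : (0 : ℝ) < n := by exact_mod_cast hn0
  have h1 : ((bd C (F n)).card : ℝ) ≤ C.Erep.card * ((n : ℝ) ^ d - ((n : ℝ) - 2 * k) ^ d) := by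
    have h2 : ((bd C (F n)).card : ℝ) ≤ ((C.Erep.card * (n ^ d - (n - 2 * k) ^ d) : ℕ) : ℝ) := by
      exact_mod_cast hbd n
    rw [Nat.cast_mul, Nat.cast_sub (Nat.pow_le_pow_left (Nat.sub_le _ _) _), Nat.cast_pow,
      Nat.cast_pow, Nat.cast_sub (by omega)] at h2
    simpa using h2
  have h3 : (C.Erep.card : ℝ) * ((n : ℝ) ^ d - ((n : ℝ) - 2 * k) ^ d) =
      (n : ℝ) ^ d * (C.Erep.card * (1 - (1 - (2 * k : ℝ) / n) ^ d)) := by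
    have : ((n : ℝ) - 2 * k) ^ d = (n : ℝ) ^ d * (1 - (2 * k : ℝ) / n) ^ d := by
      rw [← mul_pow]; congr 1; field_simp
    rw [this]; ring
  rw [h3] at h1
  have h4 : (n : ℝ) ^ d * (C.Erep.card * (1 - (1 - (2 * k : ℝ) / n) ^ d)) ≤ (n : ℝ) ^ d * ε :=
    mul_le_mul_of_nonneg_left hn1.le (by positivity)
  have h5 : (n : ℝ) ^ d * ε ≤ ε * ((F n).card : ℝ) := by
    rw [hF]; push_cast
    have : (1 : ℝ) ≤ C.Vrep.card := by exact_mod_cast hV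
    have h6 : 0 ≤ (n : ℝ) ^ d * ε := by positivity
    nlinarith
  linarith

theorem bd_aut (C : Crystal d) (σV : C.V ≃ C.V) (σE : C.E ≃ C.E)
    (ho : ∀ e, C.o (σE e) = σV (C.o e)) (ht : ∀ e, C.t (σE e) = σV (C.t e)) (S : Finset C.V) :
    (bd C (S.map σV.toEmbedding)).card = (bd C S).card := by
  rw [← Finset.card_map σE.toEmbedding (s := bd C S)]
  congr 1
  ext e
  obtain ⟨f, rfl⟩ := σE.surjective e
  simp [mem_bd, ho, ht]

/-- Local quadratic form. -/
def psi {C : Crystal d} (P : PeriodicRealization C) (w : EuclideanSpace ℝ (Fin d)) (v : C.V) : ℝ :=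
  ∑ e ∈ C.star v, (inner ℝ w (ev P e)) ^ 2

theorem qf_aut {C : Crystal d} {P : PeriodicRealization C} (v₀ : C.V)
    (σV : C.V ≃ C.V) (σE : C.E ≃ C.E)
    (ho : ∀ e, C.o (σE e) = σV (C.o e)) (ht : ∀ e, C.t (σE e) = σV (C.t e))
    (w w' : EuclideanSpace ℝ (Fin d))
    (hw : ∀ e, inner ℝ w (ev P (σE e)) = inner ℝ w' (ev P e)) : qf P w = qf P w' := by
  obtain ⟨K, hK0, hK⟩ := equidist C
  have hpos : ∀ w v, 0 ≤ psi P w v := fun w v => Finset.sum_nonneg fun _ _ => sq_nonneg _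
  have hper : ∀ w a v, psi P w (C.act a v) = psi P w v := fun w a v => by
    unfold psi; rw [sum_star_act]; simp [ev_acte]
  have hq : ∀ w, ∑ x ∈ C.Vrep, psi P w x = qf P w := fun w =>
    sum_star C (fun e => (inner ℝ w (ev P e)) ^ 2) (fun a e => by rw [ev_acte])
  have hq0 : ∀ w, 0 ≤ qf P w := fun w => Finset.sum_nonneg fun _ _ => sq_nonneg _
  have key : ∀ ε : ℝ, 0 < ε → |qf P w - qf P w'| ≤ ε * (K * (qf P w + qf P w')) := by
    intro ε hε
    obtain ⟨S, hS0, hS⟩ := folner C v₀ ε hε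
    have h1 := hK S (psi P w') (hpos _) (hper _)
    have h2 := hK (S.map σV.toEmbedding) (psi P w) (hpos _) (hper _)
    rw [bd_aut C σV σE ho ht, Finset.card_map, Finset.sum_map] at h2
    have h3 : ∑ v ∈ S, psi P w (σV.toEmbedding v) = ∑ v ∈ S, psi P w' v := by
      refine Finset.sum_congr rfl fun v _ => ?_
      unfold psi
      rw [Equiv.coe_toEmbedding, sum_star_aut C σV σE ho]
      simp only [hw]
    rw [h3, hq] at h2
    rw [hq] at h1
    have hSR : (0 : ℝ) < S.card := by exact_mod_cast hS0
    have h4 : S.card * |qf P w - qf P w'| ≤ K * (bd C S).card * (qf P w + qf P w') := by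
      rw [← abs_of_pos hSR, ← abs_mul]
      rw [abs_le] at h1 h2 ⊢
      constructor <;> nlinarith
    have h5 : K * (bd C S).card * (qf P w + qf P w') ≤ S.card * (ε * (K * (qf P w + qf P w'))) := by
      have h6 : 0 ≤ K * (qf P w + qf P w') := mul_nonneg hK0 (add_nonneg (hq0 _) (hq0 _))
      have := mul_le_mul_of_nonneg_right hS h6
      linarith
    exact le_of_mul_le_mul_left (h4.trans h5) hSR
  have hlim : |qf P w - qf P w'| ≤ 0 := by
    refine le_of_forall_pos_le_add fun δ hδ => ?_
    have h6 : 0 ≤ K * (qf P w + qf P w') := mul_nonneg hK0 (add_nonneg (hq0 _) (hq0 _))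
    refine (key (δ / (K * (qf P w + qf P w') + 1)) (by positivity)).trans ?_
    rw [zero_add, div_mul_eq_mul_div, div_le_iff₀ (by positivity)]
    nlinarith
  exact sub_eq_zero.1 (abs_nonpos_iff.1 hlim)

end CrystalAux

/-- If `Φ` is a standard realization of a `d`-dimensional topological
crystal `X`, then every automorphism `σ` of the graph `X` extends to a Euclidean motion
of `ℝ^d`: there is an element of `O(d) ⋉ ℝ^d` (an orthogonal map `A` and a translation `b`)
with `A(Φ(v)) + b = Φ(σ(v))` for every vertex `v`. -/
theorem stmt8 {d : ℕ} (C : Crystal d) (P : PeriodicRealization C) (hP : IsStandard C P)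
    (σV : C.V ≃ C.V) (σE : C.E ≃ C.E)
    (ho : ∀ e, C.o (σE e) = σV (C.o e))
    (ht : ∀ e, C.t (σE e) = σV (C.t e))
    (hbar : ∀ e, C.bar (σE e) = σE (C.bar e)) :
    ∃ (A : EuclideanSpace ℝ (Fin d) ≃ₗᵢ[ℝ] EuclideanSpace ℝ (Fin d))
      (b : EuclideanSpace ℝ (Fin d)),
      ∀ v : C.V, P.Φ (σV v) = A (P.Φ v) + b := by
  rcases isEmpty_or_nonempty C.V with hV | ⟨⟨v₀⟩⟩
  · exact ⟨LinearIsometryEquiv.refl ℝ _, 0, fun v => hV.elim v⟩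
  rcases Nat.eq_zero_or_pos d with hd | hd
  · subst hd
    exact ⟨LinearIsometryEquiv.refl ℝ _, 0, fun v => Subsingleton.elim _ _⟩
  obtain ⟨c, hc, hq⟩ := CrystalAux.qf_pos hP hd v₀
  have hharm : CrystalAux.Harm C (fun v => P.Φ (σV v)) := by
    intro v
    have h1 := CrystalAux.standard_harm hP (σV v)
    rw [CrystalAux.sum_star_aut C σV σE ho] at h1
    simpa [ho, ht] using h1
  obtain ⟨B, hB⟩ : ∃ B : ℝ, ∀ e, ‖CrystalAux.ev P e‖ ≤ B := by
    refine ⟨∑ e ∈ C.Erep, ‖CrystalAux.ev P e‖, fun e => ?_⟩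
    obtain ⟨a, x, hx, rfl⟩ := CrystalAux.exE C e
    rw [CrystalAux.ev_acte]
    exact Finset.single_le_sum (f := fun e => ‖CrystalAux.ev P e‖) (fun _ _ => norm_nonneg _) hx
  obtain ⟨L, b, hL⟩ := CrystalAux.affine hP hd v₀ _ hharm B (fun e => by
    rw [← ho, ← ht]; exact hB (σE e))
  have hev : ∀ e, CrystalAux.ev P (σE e) = L (CrystalAux.ev P e) := by
    intro e
    simp only [CrystalAux.ev, ho, ht, hL, map_sub]
    abel
  have hadj : ∀ w, ‖LinearMap.adjoint L w‖ = ‖w‖ := by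
    intro w
    have h1 := CrystalAux.qf_aut (P := P) v₀ σV σE ho ht w (LinearMap.adjoint L w) (fun e => by
      rw [hev, LinearMap.adjoint_inner_left])
    rw [hq, hq] at h1
    have h2 := mul_left_cancel₀ hc.ne' h1
    exact ((sq_eq_sq₀ (norm_nonneg _) (norm_nonneg _)).1 h2).symm
  let T : EuclideanSpace ℝ (Fin d) ≃ₗᵢ[ℝ] EuclideanSpace ℝ (Fin d) :=
    LinearIsometry.toLinearIsometryEquiv ⟨LinearMap.adjoint L, hadj⟩ rfl
  have hT : ∀ x, T x = LinearMap.adjoint L x := fun x => rfl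
  have hTL : ∀ x, T.symm x = L x := by
    intro x
    refine ext_inner_left ℝ fun y => ?_
    rw [← LinearMap.adjoint_inner_left, ← hT, ← T.inner_map_map y, T.apply_symm_apply]
  exact ⟨T.symm, b, fun v => by rw [hTL]; exact hL v⟩
end
end
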